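/- Let n ≥ 3 be an integer, let D be a digraph satisfying (D1), (D2) and (D3), let Q = v_1 v_2 ⋯ v_l be an induced directed path in D, and let Y' be a subset of N_{G_D}(V(Q)) such that N_{G_D}(y) ∩ V(Q) ⊆ {v_i : n+1 ≤ i ≤ l−n} for every y ∈ Y'. Then pc(D[V(Q) ∪ Y']) ≤ (n−2)n(n+5)/2 + 6(n−2). -/

import Mathlib

/-! ## Basic notions for graphs and digraphs

A digraph on a vertex type `V` is given by its arc relation `E : V → V → Prop`.
Simplicity and absence of 2-cycles is expressed by the hypothesis
`∀ u v, E u v → ¬ E v u`.  The underlying graph `G_D` is `SimpleGraph.fromRel E`. -/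

/-- `G` contains an induced copy of the simple graph `H`. -/
def HasInducedCopyG {W V : Type} (H : SimpleGraph W) (G : SimpleGraph V) : Prop :=
  ∃ f : W → V, Function.Injective f ∧ ∀ a b : W, G.Adj (f a) (f b) ↔ H.Adj a b

/-- The digraph `E` contains an induced copy of the digraph `H`. -/
def DigraphHasInducedCopy {W V : Type} (H : W → W → Prop) (E : V → V → Prop) : Prop :=
  ∃ f : W → V, Function.Injective f ∧ ∀ a b : W, E (f a) (f b) ↔ H a b

/-- The star `K_{1,n}` with one center and `n` leaves. -/
def StarG (n : ℕ) : SimpleGraph (Unit ⊕ Fin n) :=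
  SimpleGraph.fromRel (fun a b =>
    match a, b with
    | Sum.inl _, Sum.inr _ => True
    | _, _ => False)

/-- The path `P_n` of order `n`. -/
def PathG (n : ℕ) : SimpleGraph (Fin n) :=
  SimpleGraph.fromRel (fun i j => i.val + 1 = j.val)

/-- The graph `K*_n`: a complete graph on the `x_i` together with pendant edges `x_i y_i`. -/
def KStarG (n : ℕ) : SimpleGraph (Fin n ⊕ Fin n) :=
  SimpleGraph.fromRel (fun a b =>
    match a, b with
    | Sum.inl i, Sum.inl j => i ≠ j
    | Sum.inl i, Sum.inr j => i = j
    | _, _ => False)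

/-- The graph `F^(1)_n` on `{x₁,x₂} ∪ {yᵢ} ∪ {zᵢ}`:
edges `x₁x₂, x₁y₁, x₁z₁` together with the two paths `y₁⋯y_n` and `z₁⋯z_n`. -/
def F1G (n : ℕ) : SimpleGraph (Fin 2 ⊕ Fin n ⊕ Fin n) :=
  SimpleGraph.fromRel (fun a b =>
    match a, b with
    | Sum.inl i, Sum.inl j => i.val = 0 ∧ j.val = 1
    | Sum.inl i, Sum.inr (Sum.inl j) => i.val = 0 ∧ j.val = 0
    | Sum.inl i, Sum.inr (Sum.inr j) => i.val = 0 ∧ j.val = 0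
    | Sum.inr (Sum.inl i), Sum.inr (Sum.inl j) => i.val + 1 = j.val
    | Sum.inr (Sum.inr i), Sum.inr (Sum.inr j) => i.val + 1 = j.val
    | _, _ => False)

/-- The single edge `y₁z₁` (used to build `F^(2)_n` and `F^(4)_n`). -/
def YZEdgeG (n : ℕ) : SimpleGraph (Fin 2 ⊕ Fin n ⊕ Fin n) :=
  SimpleGraph.fromRel (fun a b =>
    match a, b with
    | Sum.inr (Sum.inl i), Sum.inr (Sum.inr j) => i.val = 0 ∧ j.val = 0
    | _, _ => False)

/-- `F^(2)_n = F^(1)_n + y₁z₁`. -/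
def F2G (n : ℕ) : SimpleGraph (Fin 2 ⊕ Fin n ⊕ Fin n) := F1G n ⊔ YZEdgeG n

/-- The graph `F^(3)_n`: edges `x₁y₁, x₁z₁, x₂y₁, x₂z₁` together with the two paths. -/
def F3G (n : ℕ) : SimpleGraph (Fin 2 ⊕ Fin n ⊕ Fin n) :=
  SimpleGraph.fromRel (fun a b =>
    match a, b with
    | Sum.inl _, Sum.inr (Sum.inl j) => j.val = 0
    | Sum.inl _, Sum.inr (Sum.inr j) => j.val = 0
    | Sum.inr (Sum.inl i), Sum.inr (Sum.inl j) => i.val + 1 = j.val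
    | Sum.inr (Sum.inr i), Sum.inr (Sum.inr j) => i.val + 1 = j.val
    | _, _ => False)

/-- `F^(4)_n = F^(3)_n + y₁z₁`. -/
def F4G (n : ℕ) : SimpleGraph (Fin 2 ⊕ Fin n ⊕ Fin n) := F3G n ⊔ YZEdgeG n

/-- The digraph `D^(1)_n` on `{x₁} ∪ {yᵢ} ∪ {zᵢ}` with arcs
`(x₁,y₁), (z₁,x₁), (y₁,z₁)`, `(y_{i+1}, y_i)` and `(z_i, z_{i+1})`. -/
def D1Rel (n : ℕ) : (Unit ⊕ Fin n ⊕ Fin n) → (Unit ⊕ Fin n ⊕ Fin n) → Prop := fun a b =>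
  match a, b with
  | Sum.inl _, Sum.inr (Sum.inl j) => j.val = 0
  | Sum.inr (Sum.inr i), Sum.inl _ => i.val = 0
  | Sum.inr (Sum.inl i), Sum.inr (Sum.inr j) => i.val = 0 ∧ j.val = 0
  | Sum.inr (Sum.inl i), Sum.inr (Sum.inl j) => j.val + 1 = i.val
  | Sum.inr (Sum.inr i), Sum.inr (Sum.inr j) => i.val + 1 = j.val
  | _, _ => False

/-- `D^(2)_n`: obtained from `D^(1)_n` by replacing the arc `(z₁,x₁)` by `(x₁,z₁)`. -/
def D2Rel (n : ℕ) : (Unit ⊕ Fin n ⊕ Fin n) → (Unit ⊕ Fin n ⊕ Fin n) → Prop := fun a b =>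
  match a, b with
  | Sum.inl _, Sum.inr (Sum.inl j) => j.val = 0
  | Sum.inl _, Sum.inr (Sum.inr j) => j.val = 0
  | Sum.inr (Sum.inl i), Sum.inr (Sum.inr j) => i.val = 0 ∧ j.val = 0
  | Sum.inr (Sum.inl i), Sum.inr (Sum.inl j) => j.val + 1 = i.val
  | Sum.inr (Sum.inr i), Sum.inr (Sum.inr j) => i.val + 1 = j.val
  | _, _ => False

/-- `D^(3)_n`: obtained from `D^(1)_n` by replacing the arc `(x₁,y₁)` by `(y₁,x₁)`. -/
def D3Rel (n : ℕ) : (Unit ⊕ Fin n ⊕ Fin n) → (Unit ⊕ Fin n ⊕ Fin n) → Prop := fun a b =>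
  match a, b with
  | Sum.inr (Sum.inl i), Sum.inl _ => i.val = 0
  | Sum.inr (Sum.inr i), Sum.inl _ => i.val = 0
  | Sum.inr (Sum.inl i), Sum.inr (Sum.inr j) => i.val = 0 ∧ j.val = 0
  | Sum.inr (Sum.inl i), Sum.inr (Sum.inl j) => j.val + 1 = i.val
  | Sum.inr (Sum.inr i), Sum.inr (Sum.inr j) => i.val + 1 = j.val
  | _, _ => False

/-- The transitive tournament `T_n`. -/
def TRel (n : ℕ) : Fin n → Fin n → Prop := fun i j => i < j

/-- A (nonempty) directed path in the digraph `E`, recorded as its list of vertices. -/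
def IsDirPathList {V : Type} (E : V → V → Prop) (l : List V) : Prop :=
  l ≠ [] ∧ l.Nodup ∧ l.Chain' E

/-- The path cover number of the subdigraph of `E` induced by `X`:
the minimum number of directed paths of `E[X]` whose vertex sets cover `X`. -/
noncomputable def pcOn {V : Type} (E : V → V → Prop) (X : Set V) : ℕ :=
  sInf {k | ∃ P : Finset (List V), P.card = k ∧
    (∀ l ∈ P, IsDirPathList E l ∧ ∀ v ∈ l, v ∈ X) ∧
    ∀ v ∈ X, ∃ l ∈ P, v ∈ l}

/-- The path partition number of the subdigraph of `E` induced by `X`: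
the minimum number of pairwise vertex-disjoint directed paths of `E[X]`
whose vertex sets partition `X`. -/
noncomputable def ppOn {V : Type} (E : V → V → Prop) (X : Set V) : ℕ :=
  sInf {k | ∃ P : Finset (List V), P.card = k ∧
    (∀ l ∈ P, IsDirPathList E l ∧ ∀ v ∈ l, v ∈ X) ∧
    (∀ v ∈ X, ∃ l ∈ P, v ∈ l) ∧
    ∀ l ∈ P, ∀ l' ∈ P, l ≠ l' → ∀ v ∈ l, v ∉ l'}

/-- A (nonempty) path in the simple graph `G`, recorded as its list of vertices. -/
def IsPathList {V : Type} (G : SimpleGraph V) (l : List V) : Prop :=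
  l ≠ [] ∧ l.Nodup ∧ l.Chain' G.Adj

/-- The path cover number `pc(G)` of a simple graph `G`. -/
noncomputable def pcG {V : Type} (G : SimpleGraph V) : ℕ :=
  sInf {k | ∃ P : Finset (List V), P.card = k ∧
    (∀ l ∈ P, IsPathList G l) ∧ ∀ v : V, ∃ l ∈ P, v ∈ l}

/-- The path partition number `pp(G)` of a simple graph `G`. -/
noncomputable def ppG {V : Type} (G : SimpleGraph V) : ℕ :=
  sInf {k | ∃ P : Finset (List V), P.card = k ∧
    (∀ l ∈ P, IsPathList G l) ∧ (∀ v : V, ∃ l ∈ P, v ∈ l) ∧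
    ∀ l ∈ P, ∀ l' ∈ P, l ≠ l' → ∀ v ∈ l, v ∉ l'}

/-- A directed cycle in the digraph `E`, recorded as its list of vertices. -/
def IsDirCycleList {V : Type} (E : V → V → Prop) (l : List V) : Prop :=
  ∃ h : l ≠ [], 3 ≤ l.length ∧ l.Nodup ∧ l.Chain' E ∧ E (l.getLast h) (l.head h)

/-- A member of a cycle cover/partition: a directed cycle, or a weakly connected
subdigraph of order at most two. -/
def IsCyclePartMember {V : Type} (E : V → V → Prop) (l : List V) : Prop :=
  IsDirCycleList E l ∨
    (l ≠ [] ∧ l.length ≤ 2 ∧ l.Nodup ∧ l.Chain' (fun a b => E a b ∨ E b a))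

/-- The cycle partition number `cp(D)` of the digraph `E`. -/
noncomputable def cpNum {V : Type} (E : V → V → Prop) : ℕ :=
  sInf {k | ∃ P : Finset (List V), P.card = k ∧
    (∀ l ∈ P, IsCyclePartMember E l) ∧
    (∀ v : V, ∃ l ∈ P, v ∈ l) ∧
    ∀ l ∈ P, ∀ l' ∈ P, l ≠ l' → ∀ v ∈ l, v ∉ l'}

/-- `v : Fin m → V` enumerates an induced path of the simple graph `G`. -/
def IsInducedPathEmb {V : Type} (G : SimpleGraph V) {m : ℕ} (v : Fin m → V) : Prop :=
  Function.Injective v ∧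
    ∀ i j : Fin m, G.Adj (v i) (v j) ↔ (i.val + 1 = j.val ∨ j.val + 1 = i.val)

/-- `w : Fin m → V` enumerates an induced pseudo-path of the digraph `E`:
the induced subdigraph on its image has a path as underlying graph. -/
def IsInducedPsPath {V : Type} (E : V → V → Prop) {m : ℕ} (w : Fin m → V) : Prop :=
  Function.Injective w ∧
    ∀ i j : Fin m, (E (w i) (w j) ∨ E (w j) (w i)) ↔ (i.val + 1 = j.val ∨ j.val + 1 = i.val)

/-- `r(P)` for a pseudo-path enumerated by `w`: the number of (internal) vertices
having out-degree 2 or in-degree 2 in the pseudo-path. -/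
noncomputable def turnCount {V : Type} (E : V → V → Prop) {m : ℕ} (w : Fin m → V) : ℕ :=
  Set.ncard {i : Fin m | ∃ j k : Fin m, j.val + 1 = i.val ∧ i.val + 1 = k.val ∧
    ((E (w i) (w j) ∧ E (w i) (w k)) ∨ (E (w j) (w i) ∧ E (w k) (w i)))}

/-- Condition (D1): the underlying graph of `E` is `{K*_n, K_{1,n}, F^(1)_n, F^(2)_n}`-free. -/
def CondD1 {V : Type} (n : ℕ) (E : V → V → Prop) : Prop :=
  ¬ HasInducedCopyG (KStarG n) (SimpleGraph.fromRel E) ∧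
  ¬ HasInducedCopyG (StarG n) (SimpleGraph.fromRel E) ∧
  ¬ HasInducedCopyG (F1G n) (SimpleGraph.fromRel E) ∧
  ¬ HasInducedCopyG (F2G n) (SimpleGraph.fromRel E)

/-- Condition (D'1): the underlying graph of `E` is
`{K*_n, K_{1,n}, F^(1)_n, F^(2)_n, F^(3)_n, F^(4)_n}`-free. -/
def CondD1' {V : Type} (n : ℕ) (E : V → V → Prop) : Prop :=
  CondD1 n E ∧
  ¬ HasInducedCopyG (F3G n) (SimpleGraph.fromRel E) ∧
  ¬ HasInducedCopyG (F4G n) (SimpleGraph.fromRel E)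

/-- Condition (D2): `E` is `{D^(1)_n, D^(2)_n, D^(3)_n}`-free. -/
def CondD2 {V : Type} (n : ℕ) (E : V → V → Prop) : Prop :=
  ¬ DigraphHasInducedCopy (D1Rel n) E ∧
  ¬ DigraphHasInducedCopy (D2Rel n) E ∧
  ¬ DigraphHasInducedCopy (D3Rel n) E

/-- Condition (D3): `r(P) ≤ n` for every induced pseudo-path `P` of `E`. -/
def CondD3 {V : Type} (n : ℕ) (E : V → V → Prop) : Prop :=
  ∀ (m : ℕ) (w : Fin m → V), IsInducedPsPath E w → turnCount E w ≤ n

/-- The Ramsey number `R(a, b)`: the least `R` such that every graph on at least `R`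
vertices contains a clique of size `a` or an independent set of size `b`. -/
noncomputable def ramseyNumber (a b : ℕ) : ℕ :=
  sInf {R | ∀ m : ℕ, R ≤ m → ∀ G : SimpleGraph (Fin m),
    (∃ s : Finset (Fin m), G.IsNClique a s) ∨ (∃ s : Finset (Fin m), Gᶜ.IsNClique b s)}

/-- The independence number of the subgraph of `G` induced by `X`. -/
noncomputable def indepNumOn {V : Type} (G : SimpleGraph V) (X : Set V) : ℕ :=
  sSup {k | ∃ s : Finset V, ↑s ⊆ X ∧ s.card = k ∧ ∀ a ∈ s, ∀ b ∈ s, a ≠ b → ¬ G.Adj a b}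

/-- The independence number `α(G)`. -/
noncomputable def indepNum {V : Type} (G : SimpleGraph V) : ℕ := indepNumOn G Set.univ

/-- The neighborhood `N_G(X)` of a set of vertices. -/
def nbhd {V : Type} (G : SimpleGraph V) (X : Set V) : Set V :=
  {v | v ∉ X ∧ ∃ x ∈ X, G.Adj v x}

/-! ## Path covers and independent sets -/

/-- `PathEnds E X T`: the finite set `X` can be partitioned into directed paths of `E`
whose terminal vertices are exactly the elements of `T`. -/
inductive PathEnds {V : Type} [DecidableEq V] (E : V → V → Prop) : Finset V → Finset V → Prop
  | empty : PathEnds E ∅ ∅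
  | single {X T : Finset V} (v : V) : v ∉ X → PathEnds E X T →
      PathEnds E (insert v X) (insert v T)
  | extend {X T : Finset V} (v t : V) : v ∉ X → t ∈ T → E t v → PathEnds E X T →
      PathEnds E (insert v X) (insert v (T.erase t))

namespace PathEnds

variable {V : Type} [DecidableEq V] {E : V → V → Prop}

theorem subset {X T : Finset V} (h : PathEnds E X T) : T ⊆ X := by
  induction h with
  | empty => simp
  | single v hv h ih => exact Finset.insert_subset_insert _ ih
  | extend v t hv ht hE h ih =>
    exact Finset.insert_subset_insert _ ((Finset.erase_subset _ _).trans ih)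

theorem self (X : Finset V) : PathEnds E X X := by
  induction X using Finset.induction_on with
  | empty => exact .empty
  | insert a s ha ih => exact .single a ha ih

/-- A terminal vertex can be removed: either it was a trivial path, or its predecessor
becomes a terminal vertex. -/
theorem erase {X T : Finset V} (h : PathEnds E X T) {a : V} (ha : a ∈ T) :
    PathEnds E (X.erase a) (T.erase a) ∨
      ∃ u ∈ X, u ≠ a ∧ u ∉ T ∧ E u a ∧ PathEnds E (X.erase a) (insert u (T.erase a)) := by
  induction h with
  | empty => simp at ha
  | @single X T v hv h ih =>
    have hvT : v ∉ T := fun hc => hv (h.subset hc)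
    by_cases hav : a = v
    · subst hav
      left
      simpa [Finset.erase_insert hv, Finset.erase_insert hvT] using h
    · have haT : a ∈ T := by simpa [hav] using ha
      have hva : v ≠ a := fun hc => hav hc.symm
      have hvX : v ∉ X.erase a := fun hc => hv (Finset.mem_of_mem_erase hc)
      rw [Finset.erase_insert_of_ne hva, Finset.erase_insert_of_ne hva]
      rcases ih haT with h' | ⟨u, huX, hua, huT, hE, h'⟩
      · exact Or.inl (.single v hvX h')
      · refine Or.inr ⟨u, by simp [huX], hua, ?_, hE, ?_⟩
        · have : u ≠ v := fun hc => hv (hc ▸ huX)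
          simp [this, huT]
        · rw [Finset.insert_comm]
          exact .single v hvX h'
  | @extend X T v t hv ht hEt h ih =>
    have hvT : v ∉ T := fun hc => hv (h.subset hc)
    by_cases hav : a = v
    · subst hav
      right
      have hta : t ≠ a := fun hc => hvT (hc ▸ ht)
      refine ⟨t, by simp [h.subset ht], hta, by simp [hta], hEt, ?_⟩
      have e : insert t ((insert a (T.erase t)).erase a) = T := by
        rw [Finset.erase_insert (fun hc => hvT (Finset.mem_of_mem_erase hc)),
          Finset.insert_erase ht]
      rw [e, Finset.erase_insert hv]
      exact h
    · have haT : a ∈ T ∧ a ≠ t := by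
        simp only [Finset.mem_insert, hav, false_or, Finset.mem_erase] at ha
        exact ⟨ha.2, ha.1⟩
      have hva : v ≠ a := fun hc => hav hc.symm
      have hvX : v ∉ X.erase a := fun hc => hv (Finset.mem_of_mem_erase hc)
      rw [Finset.erase_insert_of_ne hva, Finset.erase_insert_of_ne hva]
      rcases ih haT.1 with hpe | ⟨u, huX, hua, huT, hE, hpe⟩
      · left
        rw [Finset.erase_right_comm]
        exact .extend v t hvX (by simp [ht, haT.2.symm]) hEt hpe
      · refine Or.inr ⟨u, by simp [huX], hua, ?_, hE, ?_⟩
        · have : u ≠ v := fun hc => hv (hc ▸ huX)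
          simp [this, huT]
        · have hut : u ≠ t := fun hc => huT (hc ▸ ht)
          rw [Finset.insert_comm, Finset.erase_right_comm, ← Finset.erase_insert_of_ne hut]
          exact .extend v t hvX (by simp [ht, haT.2.symm]) hEt hpe

/-- If the set of terminal vertices is inclusion-minimal, there is an independent set
with as many vertices as there are paths. -/
theorem exists_indep_of_minimal {X T : Finset V} (h : PathEnds E X T)
    (hmin : ∀ T' ⊂ T, ¬ PathEnds E X T') :
    ∃ S ⊆ X, S.card = T.card ∧ ∀ a ∈ S, ∀ b ∈ S, a ≠ b → ¬ E a b := by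
  induction hk : X.card generalizing X T with
  | zero =>
    obtain rfl : X = ∅ := Finset.card_eq_zero.mp hk
    exact ⟨T, h.subset, rfl, fun a ha => absurd (h.subset ha) (by simp)⟩
  | succ k ih =>
    by_cases hind : ∀ a ∈ T, ∀ b ∈ T, a ≠ b → ¬ E a b
    · exact ⟨T, h.subset, rfl, hind⟩
    push Not at hind
    obtain ⟨b, hb, a, ha, hba, hE⟩ := hind
    have haX := h.subset ha
    have hbT : b ∈ T.erase a := by simp [hb, hba]
    have key : ∀ T', PathEnds E (insert a (X.erase a)) T' → T' ⊆ T →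
        (∃ c ∈ T, c ∉ T') → False := by
      rintro T' hT' hsub ⟨c, hc, hc'⟩
      rw [Finset.insert_erase haX] at hT'
      exact hmin T' ⟨hsub, fun hs => hc' (hs hc)⟩ hT'
    have haX' : a ∉ X.erase a := by simp
    rcases h.erase ha with h' | ⟨u, huX, hua, huT, hEu, h'⟩
    · refine (key _ (.extend a b haX' hbT hE h') ?_ ⟨b, hb, by simp [hba]⟩).elim
      intro x; simp only [Finset.mem_insert, Finset.mem_erase]; rintro (rfl | hx)
      · exact ha
      · exact hx.2.2
    · obtain ⟨S, hSX, hS, hSi⟩ := ih h' (by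
        rintro T' ⟨hT'1, hT'2⟩ hT'
        have hsub : ∀ x ∈ T', x ≠ u → x ∈ T := fun x hx hxu => by
          have := hT'1 hx
          simp only [Finset.mem_insert, Finset.mem_erase, hxu, false_or] at this
          exact this.2
        have haT' : a ∉ T' := fun hc => by
          have := hT'1 hc
          simp [hua.symm] at this
        by_cases hu : u ∈ T'
        · refine key _ (.extend a u haX' hu hEu hT') ?_ ?_
          · intro x; simp only [Finset.mem_insert, Finset.mem_erase]; rintro (rfl | hx)
            · exact ha
            · exact hsub x hx.2 hx.1
          · obtain ⟨c, hc, hcT'⟩ := Finset.not_subset.mp hT'2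
            have hcu : c ≠ u := fun e => hcT' (e ▸ hu)
            simp only [Finset.mem_insert, hcu, false_or, Finset.mem_erase] at hc
            exact ⟨c, hc.2, by simp [hc.1, hcT']⟩
        · by_cases hbT' : b ∈ T'
          · refine key _ (.extend a b haX' hbT' hE hT') ?_ ⟨b, hb, by simp [hba]⟩
            intro x; simp only [Finset.mem_insert, Finset.mem_erase]; rintro (rfl | hx)
            · exact ha
            · exact hsub x hx.2 (fun e => hu (e ▸ hx.2))
          · refine key _ (.single a haX' hT') ?_ ⟨b, hb, by simp [hba, hbT']⟩
            intro x; simp only [Finset.mem_insert]; rintro (rfl | hx)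
            · exact ha
            · exact hsub x hx (fun e => hu (e ▸ hx)))
        (by rw [Finset.card_erase_of_mem haX, hk]; rfl)
      refine ⟨S, hSX.trans (Finset.erase_subset _ _), ?_, hSi⟩
      rw [hS, Finset.card_insert_of_notMem (by simp [huT]), Finset.card_erase_of_mem ha]
      have := Finset.card_pos.mpr ⟨a, ha⟩
      omega

theorem exists_paths {X T : Finset V} (h : PathEnds E X T) :
    ∃ f : V → List V, (∀ t ∈ T, (f t).Nodup ∧ (f t).IsChain E ∧ (f t).getLast? = some t ∧
      ∀ x ∈ f t, x ∈ X) ∧ ∀ x ∈ X, ∃ t ∈ T, x ∈ f t := by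
  induction h with
  | empty => exact ⟨fun _ => [], by simp, by simp⟩
  | @single X T v hv h ih =>
    have hvT : v ∉ T := fun hc => hv (h.subset hc)
    obtain ⟨f, hf, hc⟩ := ih
    have hne : ∀ t ∈ T, t ≠ v := fun t ht e => hvT (e ▸ ht)
    refine ⟨Function.update f v [v], ?_, ?_⟩
    · intro t ht
      rcases Finset.mem_insert.mp ht with rfl | ht
      · simp
      · obtain ⟨h1, h2, h3, h4⟩ := hf t ht
        rw [Function.update_of_ne (hne t ht)]
        exact ⟨h1, h2, h3, fun x hx => Finset.mem_insert_of_mem (h4 x hx)⟩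
    · intro x hx
      rcases Finset.mem_insert.mp hx with rfl | hx
      · exact ⟨x, by simp, by simp⟩
      · obtain ⟨t, ht, hxt⟩ := hc x hx
        exact ⟨t, by simp [ht], by rwa [Function.update_of_ne (hne t ht)]⟩
  | @extend X T v s hv hs hE h ih =>
    have hvT : v ∉ T := fun hc => hv (h.subset hc)
    obtain ⟨f, hf, hc⟩ := ih
    have hne : ∀ t ∈ T, t ≠ v := fun t ht e => hvT (e ▸ ht)
    refine ⟨Function.update f v (f s ++ [v]), ?_, ?_⟩
    · intro t ht
      rcases Finset.mem_insert.mp ht with rfl | ht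
      · obtain ⟨h1, h2, h3, h4⟩ := hf s hs
        rw [Function.update_self]
        refine ⟨?_, ?_, by simp, ?_⟩
        · rw [List.nodup_append]
          refine ⟨h1, by simp, ?_⟩
          rintro a ha b hb rfl
          rw [List.mem_singleton] at hb
          exact hv (hb ▸ h4 _ ha)
        · rw [List.isChain_append]
          refine ⟨h2, by simp, ?_⟩
          intro x hx y hy
          rw [h3] at hx
          simp at hx hy
          subst hx hy
          exact hE
        · intro x hx
          rcases List.mem_append.mp hx with hx | hx
          · exact Finset.mem_insert_of_mem (h4 x hx)
          · simp only [List.mem_singleton] at hx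
            simp [hx]
      · have ht' := Finset.mem_of_mem_erase ht
        obtain ⟨h1, h2, h3, h4⟩ := hf t ht'
        rw [Function.update_of_ne (hne t ht')]
        exact ⟨h1, h2, h3, fun x hx => Finset.mem_insert_of_mem (h4 x hx)⟩
    · intro x hx
      rcases Finset.mem_insert.mp hx with rfl | hx
      · exact ⟨x, by simp, by simp⟩
      · obtain ⟨t, ht, hxt⟩ := hc x hx
        by_cases hts : t = s
        · subst hts
          exact ⟨v, by simp, by simp [hxt]⟩
        · exact ⟨t, by simp [ht, hts], by rwa [Function.update_of_ne (hne t ht)]⟩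

end PathEnds

/-- Gallai–Milgram: if every independent subset of `X` has at most `k` elements, then `X` is
covered by `k` (possibly empty) directed paths inside `X`. -/
theorem exists_path_cover_of_indep_le {V : Type} (E : V → V → Prop) (X : Finset V) (k : ℕ)
    (hX : ∀ S ⊆ X, (∀ a ∈ S, ∀ b ∈ S, a ≠ b → ¬ E a b) → S.card ≤ k) :
    ∃ f : Fin k → List V, (∀ i, (f i).Nodup ∧ (f i).IsChain E ∧ ∀ x ∈ f i, x ∈ X) ∧
      ∀ x ∈ X, ∃ i, x ∈ f i := by
  classical
  obtain ⟨T, hT, hmin⟩ : ∃ T, PathEnds E X T ∧ ∀ T' ⊂ T, ¬ PathEnds E X T' := by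
    obtain ⟨T, hT⟩ := exists_minimal_of_wellFoundedLT (fun T => PathEnds E X T)
      ⟨X, PathEnds.self X⟩
    exact ⟨T, hT.prop, fun T' hT' h => hT'.2 (hT.le_of_le h hT'.1)⟩
  obtain ⟨S, hSX, hS, hSi⟩ := hT.exists_indep_of_minimal hmin
  have hTk : T.card ≤ k := hS ▸ hX S hSX hSi
  obtain ⟨g, hg, hgc⟩ := hT.exists_paths
  let e := T.equivFin
  refine ⟨fun i => if h : i.val < T.card then g (e.symm ⟨i.val, h⟩) else [], ?_, ?_⟩
  · intro i
    by_cases h : i.val < T.card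
    · simp only [h, dif_pos]
      obtain ⟨h1, h2, -, h4⟩ := hg _ (e.symm ⟨i.val, h⟩).2
      exact ⟨h1, h2, h4⟩
    · simp [h]
  · intro x hx
    obtain ⟨t, ht, hxt⟩ := hgc x hx
    refine ⟨⟨e ⟨t, ht⟩, (e ⟨t, ht⟩).2.trans_le hTk⟩, ?_⟩
    simpa using hxt

/-! ## Finding induced copies of the forbidden graphs -/

/-- `u 0, …, u (m - 1)` is an induced path of `G`. -/
def IsInducedPathSeq {V : Type} (G : SimpleGraph V) (m : ℕ) (u : ℕ → V) : Prop :=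
  ∀ i j, i < m → j < m →
    (u i = u j → i = j) ∧ (G.Adj (u i) (u j) ↔ i + 1 = j ∨ j + 1 = i)

/-- A vertex attached only to the middle of an induced path gives `F^(1)_n`. -/
theorem hasInducedCopyG_F1G {V : Type} {G : SimpleGraph V} {n : ℕ} {u : ℕ → V} {x : V}
    (hu : IsInducedPathSeq G (2 * n + 1) u)
    (hx : ∀ i < 2 * n + 1, x ≠ u i ∧ (G.Adj x (u i) ↔ i = n)) :
    HasInducedCopyG (F1G n) G := by
  have hx' : ∀ i < 2 * n + 1, u i ≠ x ∧ (G.Adj (u i) x ↔ i = n) := fun i hi =>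
    ⟨(hx i hi).1.symm, by rw [G.adj_comm]; exact (hx i hi).2⟩
  refine ⟨fun a => match a with
    | Sum.inl i => if i.val = 0 then u n else x
    | Sum.inr (Sum.inl j) => u (n - 1 - j.val)
    | Sum.inr (Sum.inr j) => u (n + 1 + j.val), ?_, ?_⟩
  · rintro (i | i | i) (j | j | j) h <;> dsimp only at h <;> have hi := i.isLt <;>
      have hj := j.isLt <;> unfold IsInducedPathSeq at hu <;>
      simp only [Sum.inl.injEq, Sum.inr.injEq, Fin.ext_iff, reduceCtorEq] <;>
      grind
  · rintro (i | i | i) (j | j | j) <;> dsimp only <;> have hi := i.isLt <;>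
      have hj := j.isLt <;> unfold IsInducedPathSeq at hu <;>
      simp only [F1G, SimpleGraph.fromRel_adj, ne_eq,
        Sum.inl.injEq, Sum.inr.injEq, Fin.ext_iff, reduceCtorEq] <;>
      grind [G.irrefl]

/-- A triangle on two middle vertices of an induced path, with a pendant vertex,
gives `F^(2)_n`. -/
theorem hasInducedCopyG_F2G {V : Type} {G : SimpleGraph V} {n : ℕ} {u : ℕ → V} {x y : V}
    (hu : IsInducedPathSeq G (2 * n) u) (hxy : G.Adj x y)
    (hx : ∀ i < 2 * n, x ≠ u i ∧ (G.Adj x (u i) ↔ i + 1 = n ∨ i = n))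
    (hy : ∀ i < 2 * n, y ≠ u i ∧ ¬ G.Adj y (u i)) :
    HasInducedCopyG (F2G n) G := by
  have hne := hxy.ne
  have hxy' := hxy.symm
  have hx' : ∀ i < 2 * n, u i ≠ x ∧ (G.Adj (u i) x ↔ i + 1 = n ∨ i = n) := fun i hi =>
    ⟨(hx i hi).1.symm, by rw [G.adj_comm]; exact (hx i hi).2⟩
  have hy' : ∀ i < 2 * n, u i ≠ y ∧ ¬ G.Adj (u i) y := fun i hi =>
    ⟨(hy i hi).1.symm, by rw [G.adj_comm]; exact (hy i hi).2⟩
  refine ⟨fun a => match a with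
    | Sum.inl i => if i.val = 0 then x else y
    | Sum.inr (Sum.inl j) => u (n - 1 - j.val)
    | Sum.inr (Sum.inr j) => u (n + j.val), ?_, ?_⟩
  · rintro (i | i | i) (j | j | j) h <;> dsimp only at h <;> have hi := i.isLt <;>
      have hj := j.isLt <;> unfold IsInducedPathSeq at hu <;>
      simp only [Sum.inl.injEq, Sum.inr.injEq, Fin.ext_iff, reduceCtorEq] <;>
      grind
  · rintro (i | i | i) (j | j | j) <;> dsimp only <;> have hi := i.isLt <;>
      have hj := j.isLt <;> unfold IsInducedPathSeq at hu <;>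
      simp only [F2G, F1G, YZEdgeG, SimpleGraph.sup_adj, SimpleGraph.fromRel_adj, ne_eq,
        Sum.inl.injEq, Sum.inr.injEq, Fin.ext_iff, reduceCtorEq] <;>
      grind [G.irrefl]

/-- An independent set of `n` neighbors of a vertex gives a star. -/
theorem hasInducedCopyG_StarG {V : Type} {G : SimpleGraph V} {n : ℕ} {c : V} {S : Finset V}
    (hS : S.card = n) (hc : ∀ s ∈ S, G.Adj c s)
    (hi : ∀ a ∈ S, ∀ b ∈ S, a ≠ b → ¬ G.Adj a b) :
    HasInducedCopyG (StarG n) G := by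
  subst hS
  let e := S.equivFin.symm
  have hce : ∀ i, G.Adj c (e i) := fun i => hc _ (e i).2
  have hee : ∀ i j, ¬ G.Adj (e i) (e j) := fun i j h =>
    hi _ (e i).2 _ (e j).2 h.ne h
  refine ⟨fun a => match a with
    | Sum.inl _ => c
    | Sum.inr j => e j, ?_, ?_⟩
  · rintro (i | i) (j | j) h
    · rfl
    · exact absurd h (hce j).ne
    · exact absurd h (hce i).ne'
    · exact congrArg _ (e.injective (Subtype.ext h))
  · rintro (i | i) (j | j)
    · simp [StarG]
    · simpa [StarG] using hce j
    · simpa [StarG] using (hce i).symm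
    · simpa [StarG] using hee i j

/-- In a digraph without `D^(1)_n`, `D^(2)_n`, `D^(3)_n`, a vertex whose neighbors on an induced
directed path are the two middle ones can be inserted between them. -/
theorem CondD2.insertable {V : Type} {E : V → V → Prop} {n : ℕ} (h2 : CondD2 n E)
    (hE : ∀ u v : V, E u v → ¬ E v u) {u : ℕ → V} {x : V}
    (hu : ∀ i j, i < 2 * n → j < 2 * n → (u i = u j → i = j) ∧ (E (u i) (u j) ↔ i + 1 = j))
    (hx : ∀ i < 2 * n, x ≠ u i ∧ (E x (u i) ∨ E (u i) x ↔ i + 1 = n ∨ i = n))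
    (hn : 0 < n) :
    E (u (n - 1)) x ∧ E x (u n) := by
  obtain ⟨hD1, hD2, hD3⟩ := h2
  have hxx : ¬ E x x := fun h => hE _ _ h h
  have hp := hx (n - 1) (by omega)
  have hq := hx n (by omega)
  let f : (Unit ⊕ Fin n ⊕ Fin n) → V := fun a => match a with
    | Sum.inl _ => x
    | Sum.inr (Sum.inl j) => u (n - 1 - j.val)
    | Sum.inr (Sum.inr j) => u (n + j.val)
  have hf : Function.Injective f := by
    rintro (i | i | i) (j | j | j) h <;> dsimp only [f] at h <;>
      simp only [Sum.inl.injEq, Sum.inr.injEq, Fin.ext_iff, reduceCtorEq] <;> grind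
  by_contra hcon
  by_cases hpx : E (u (n - 1)) x
  · refine hD3 ⟨f, hf, ?_⟩
    have hqx : E (u n) x := by grind
    rintro (i | i | i) (j | j | j) <;> dsimp only [f, D3Rel] <;> grind
  · by_cases hxq : E x (u n)
    · refine hD2 ⟨f, hf, ?_⟩
      rintro (i | i | i) (j | j | j) <;> dsimp only [f, D2Rel] <;> grind
    · refine hD1 ⟨f, hf, ?_⟩
      rintro (i | i | i) (j | j | j) <;> dsimp only [f, D1Rel] <;> grind

/-! ## Vertices attached to an induced directed path -/

/-- `w 0, …, w (l - 1)` is an induced directed path of `E`. -/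
structure IsInducedDirPathSeq {V : Type} (E : V → V → Prop) (l : ℕ) (w : ℕ → V) : Prop where
  inj : ∀ i j, i < l → j < l → w i = w j → i = j
  arc_iff : ∀ i j, i < l → j < l → (E (w i) (w j) ↔ i + 1 = j)

theorem IsInducedDirPathSeq.isInducedPathSeq {V : Type} {E : V → V → Prop} {l : ℕ} {w : ℕ → V}
    (hw : IsInducedDirPathSeq E l w) : IsInducedPathSeq (SimpleGraph.fromRel E) l w := by
  intro i j hi hj
  have h1 := hw.inj i j hi hj
  have h2 := hw.arc_iff i j hi hj
  have h3 := hw.arc_iff j i hj hi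
  refine ⟨h1, ?_⟩
  rw [SimpleGraph.fromRel_adj, h2, h3]
  refine ⟨fun h => h.2, fun h => ⟨fun e => ?_, h⟩⟩
  have := h1 e
  omega

/-- `y` is a vertex off the path `w 0, …, w (l - 1)` whose first and last neighbors on the path
are `w p` and `w q`. -/
structure IsSpan {V : Type} (G : SimpleGraph V) (l : ℕ) (w : ℕ → V) (y : V) (p q : ℕ) :
    Prop where
  le : p ≤ q
  lt : q < l
  adj_left : G.Adj y (w p)
  adj_right : G.Adj y (w q)
  bounds : ∀ i < l, G.Adj y (w i) → p ≤ i ∧ i ≤ q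
  ne : ∀ i < l, y ≠ w i

section Span

variable {V : Type} {G : SimpleGraph V} {l : ℕ} {w : ℕ → V}

theorem exists_isSpan {y : V} (hne : ∀ i < l, y ≠ w i) (h : ∃ i < l, G.Adj y (w i)) :
    ∃ p q, IsSpan G l w y p q := by
  classical
  let S := (Finset.range l).filter fun i => G.Adj y (w i)
  have hS : S.Nonempty := by
    obtain ⟨i, hi, h⟩ := h
    exact ⟨i, by simp [S, hi, h]⟩
  have hmem : ∀ i, i ∈ S ↔ i < l ∧ G.Adj y (w i) := fun i => by simp [S]
  have hmin := (hmem _).mp (S.min'_mem hS)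
  have hmax := (hmem _).mp (S.max'_mem hS)
  exact ⟨S.min' hS, S.max' hS, S.min'_le _ (S.max'_mem hS), hmax.1, hmin.2, hmax.2,
    fun i hi h => ⟨S.min'_le _ ((hmem i).mpr ⟨hi, h⟩), S.le_max' _ ((hmem i).mpr ⟨hi, h⟩)⟩, hne⟩

theorem IsSpan.unique {y : V} {p q p' q' : ℕ} (h : IsSpan G l w y p q)
    (h' : IsSpan G l w y p' q') : p = p' ∧ q = q' := by
  have a := h.bounds p' (h'.le.trans_lt h'.lt) h'.adj_left
  have b := h.bounds q' h'.lt h'.adj_right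
  have c := h'.bounds p (h.le.trans_lt h.lt) h.adj_left
  have d := h'.bounds q h.lt h.adj_right
  omega

/-- The path `w s, …, w p, y, w q, w (q + 1), …`. -/
def detour (w : ℕ → V) (y : V) (s p q : ℕ) (i : ℕ) : V :=
  if s + i ≤ p then w (s + i) else if s + i = p + 1 then y else w (s + i + q - (p + 2))

theorem IsSpan.isInducedPathSeq_detour (hw : IsInducedPathSeq G l w) {y : V} {p q : ℕ}
    (h : IsSpan G l w y p q) (hpq : p + 2 ≤ q) {s m : ℕ}
    (hm : s + m + q ≤ l + p + 2) : IsInducedPathSeq G m (detour w y s p q) := by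
  obtain ⟨h0, hq, hp1, hq1, hb, hne⟩ := h
  have hy : ∀ i < l, (G.Adj (w i) y → p ≤ i ∧ i ≤ q) ∧ w i ≠ y := fun i hi =>
    ⟨fun h => hb i hi h.symm, (hne i hi).symm⟩
  have hyp := hp1.symm
  have hyq := hq1.symm
  have hyy : ¬ G.Adj y y := G.irrefl
  unfold IsInducedPathSeq at hw ⊢
  intro i j hi hj
  unfold detour
  split_ifs <;> grind

/-- The first and last neighbors of an attached vertex are distinct and at distance at
most three on the path. -/
theorem IsSpan.length_bounds {n : ℕ} (hF1 : ¬ HasInducedCopyG (F1G n) G)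
    (hF2 : ¬ HasInducedCopyG (F2G n) G) (hn : 3 ≤ n)
    (hw : IsInducedPathSeq G l w) {y : V} {p q : ℕ}
    (h : IsSpan G l w y p q) (hp : n ≤ p) (hq : q + n + 1 ≤ l) : p < q ∧ q ≤ p + 3 := by
  have hpl := h.adj_left
  have hb := h.bounds
  have hne := h.ne
  have hle := h.le
  refine ⟨?_, ?_⟩
  · by_contra hcon
    obtain rfl : p = q := by omega
    refine hF1 (hasInducedCopyG_F1G (u := fun i => w (p - n + i)) (x := y) ?_ ?_)
    · intro i j hi hj
      have := hw (p - n + i) (p - n + j) (by omega) (by omega)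
      refine ⟨fun h => by have := this.1 h; omega, this.2.trans ?_⟩
      omega
    · intro i hi
      refine ⟨hne _ (by omega), fun h => ?_, ?_⟩
      · have := hb _ (by omega) h
        omega
      · rintro rfl
        rwa [Nat.sub_add_cancel hp]
  · by_contra hcon
    unfold IsInducedPathSeq at hw
    by_cases h1 : G.Adj y (w (p + 1))
    · by_cases hm : ∃ m, p + 2 ≤ m ∧ m + 2 ≤ q ∧ G.Adj y (w m)
      · obtain ⟨m, hm1, hm2, hm⟩ := hm
        refine hF1 (hasInducedCopyG_F1G (x := w m)
          (h.isInducedPathSeq_detour hw (s := p + 1 - n) (by omega) (by omega)) ?_)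
        intro i hi
        have := hm.symm
        have := hne m (by omega)
        unfold detour
        split_ifs <;> grind
      · refine hF2 (hasInducedCopyG_F2G (x := w (p + 1)) (y := w (p + 2))
          (h.isInducedPathSeq_detour hw (s := p + 1 - n) (by omega) (by omega))
          ?_ ?_ ?_)
        · rw [(hw _ _ (by omega) (by omega)).2]
          omega
        · intro i hi
          have := h1.symm
          have := hne (p + 1) (by omega)
          unfold detour
          split_ifs <;> grind
        · intro i hi
          have : ¬ G.Adj (w (p + 2)) y := fun hc => hm ⟨p + 2, by omega, by omega, hc.symm⟩
          have := hne (p + 2) (by omega)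
          unfold detour
          split_ifs <;> grind
    · refine hF1 (hasInducedCopyG_F1G (x := w (p + 1))
          (h.isInducedPathSeq_detour hw (s := p - n) (by omega) (by omega)) ?_)
      intro i hi
      have : ¬ G.Adj (w (p + 1)) y := fun hc => h1 hc.symm
      have := hne (p + 1) (by omega)
      unfold detour
      split_ifs <;> grind

/-- Attached vertices with disjoint spans of length at least two are not adjacent. -/
theorem IsSpan.not_adj {n : ℕ} (hF1 : ¬ HasInducedCopyG (F1G n) G) (hn : 3 ≤ n)
    (hw : IsInducedPathSeq G l w) {y y' : V} {p q p' q' : ℕ}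
    (h : IsSpan G l w y p q) (h' : IsSpan G l w y' p' q') (hp : n ≤ p) (hq : q' + n + 1 ≤ l)
    (hpq : p + 2 ≤ q) (hqp : q < p') (hpq' : p' + 2 ≤ q') : ¬ G.Adj y y' := by
  intro hadj
  obtain ⟨-, hq0, hp1, hq1, hb, hne⟩ := h
  obtain ⟨-, hq0', hp1', hq1', hb', hne'⟩ := h'
  have hy : ∀ i < l, (G.Adj (w i) y → p ≤ i ∧ i ≤ q) ∧ w i ≠ y := fun i hi =>
    ⟨fun h => hb i hi h.symm, (hne i hi).symm⟩
  have hy' : ∀ i < l, (G.Adj (w i) y' → p' ≤ i ∧ i ≤ q') ∧ w i ≠ y' := fun i hi =>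
    ⟨fun h => hb' i hi h.symm, (hne' i hi).symm⟩
  have s1 := hp1.symm
  have s2 := hq1.symm
  have s3 := hq1'.symm
  have s4 := hadj.symm
  have s5 := hadj.ne
  have s6 : ¬ G.Adj y y := G.irrefl
  have s7 : ¬ G.Adj y' y' := G.irrefl
  have hl : ∀ i ≤ p, (G.Adj (w i) y ↔ i = p) ∧ (G.Adj y (w i) ↔ i = p) ∧
      ¬ G.Adj (w i) y' ∧ ¬ G.Adj y' (w i) ∧ w i ≠ y ∧ w i ≠ y' := by grind
  have hr : ∀ i < l, q' ≤ i → (G.Adj (w i) y' ↔ i = q') ∧ (G.Adj y' (w i) ↔ i = q') ∧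
      ¬ G.Adj (w i) y ∧ ¬ G.Adj y (w i) ∧ w i ≠ y ∧ w i ≠ y' := by grind
  have hyq' : ¬ G.Adj (w q) y' ∧ w q ≠ y ∧ w q ≠ y' := by grind
  clear hb hb' hy hy' hne hne' hq1 hp1 hp1' hq1' s1 s3
  obtain ⟨u, hu⟩ : ∃ u : ℕ → V, ∀ i < 2 * n + 1,
      (∃ a, i < n ∧ a + n = p + 1 + i ∧ u i = w a) ∨ (i = n ∧ u i = y) ∨
      (i = n + 1 ∧ u i = y') ∨ ∃ b, n + 2 ≤ i ∧ b + n + 2 = q' + i ∧ u i = w b := by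
    refine ⟨fun i => if i < n then w (p + 1 - n + i) else if i = n then y else
      if i = n + 1 then y' else w (q' + i - (n + 2)), fun i hi => ?_⟩
    dsimp only
    split_ifs with h1 h2 h3
    · exact Or.inl ⟨_, h1, by omega, rfl⟩
    · exact Or.inr (Or.inl ⟨h2, rfl⟩)
    · exact Or.inr (Or.inr (Or.inl ⟨h3, rfl⟩))
    · exact Or.inr (Or.inr (Or.inr ⟨_, by omega, by omega, rfl⟩))
  refine hF1 (hasInducedCopyG_F1G (x := w q) (u := u) ?_ ?_)
  · intro i j hi hj
    rcases hu i hi with ⟨a, hi', ha, e⟩ | ⟨hi', e⟩ | ⟨hi', e⟩ | ⟨a, hi', ha, e⟩ <;>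
    rcases hu j hj with ⟨b, hj', hb, e'⟩ | ⟨hj', e'⟩ | ⟨hj', e'⟩ | ⟨b, hj', hb, e'⟩ <;>
    rw [e, e'] <;> clear e e' hu <;> first
      | have h := hw a b (by omega) (by omega)
        exact ⟨fun e => by have := h.1 e; omega, h.2.trans (by omega)⟩
      | clear hw
        grind
  · intro i hi
    rcases hu i hi with ⟨a, hi', ha, e⟩ | ⟨hi', e⟩ | ⟨hi', e⟩ | ⟨a, hi', ha, e⟩ <;>
    rw [e] <;> clear e hu <;> first
      | have h := hw q a (by omega) (by omega)
        exact ⟨fun e => by have := h.1 e; omega, h.2.trans (by omega)⟩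
      | clear hw
        grind

end Span

/-- If all vertices of `X` have `w p` as their first neighbor on the path, then `X` is covered by
`n - 2` (possibly empty) directed paths. -/
theorem exists_paths_of_common_start {V : Type} {E : V → V → Prop} {n l p : ℕ} {w : ℕ → V}
    (hK : ¬ HasInducedCopyG (StarG n) (SimpleGraph.fromRel E)) (hn : 3 ≤ n)
    (hw : IsInducedDirPathSeq E l w) (hp : 0 < p) (X : Finset V)
    (hX : ∀ y ∈ X, ∃ q, IsSpan (SimpleGraph.fromRel E) l w y p q) :
    ∃ f : Fin (n - 2) → List V,
      (∀ i, (f i).Nodup ∧ (f i).IsChain E ∧ ∀ x ∈ f i, x ∈ X) ∧ ∀ x ∈ X, ∃ i, x ∈ f i := by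
  classical
  apply exists_path_cover_of_indep_le
  intro S hSX hS
  by_contra hcon
  obtain ⟨S', hS', hcard⟩ := Finset.exists_subset_card_eq (show n - 1 ≤ S.card by omega)
  have hsp : ∀ y ∈ S', ∃ q, IsSpan (SimpleGraph.fromRel E) l w y p q :=
    fun y hy => hX y (hSX (hS' hy))
  obtain ⟨y₀, hy₀⟩ : S'.Nonempty := Finset.card_pos.mp (by omega)
  have hpl : p < l := by
    obtain ⟨q, h⟩ := hsp y₀ hy₀
    exact h.le.trans_lt h.lt
  have hnot : ∀ y ∈ S', y ≠ w (p - 1) ∧ ¬ (SimpleGraph.fromRel E).Adj y (w (p - 1)) := by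
    intro y hy
    obtain ⟨q, h⟩ := hsp y hy
    refine ⟨h.ne _ (by omega), fun hc => ?_⟩
    have := h.bounds _ (by omega) hc
    omega
  refine hK (hasInducedCopyG_StarG (c := w p) (S := insert (w (p - 1)) S') ?_ ?_ ?_)
  · rw [Finset.card_insert_of_notMem (fun hc => (hnot _ hc).1 rfl)]
    omega
  · intro s hs
    rcases Finset.mem_insert.mp hs with rfl | hs
    · rw [(hw.isInducedPathSeq _ _ hpl (by omega)).2]
      omega
    · obtain ⟨q, h⟩ := hsp s hs
      exact h.adj_left.symm
  · intro a ha b hb hab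
    rcases Finset.mem_insert.mp ha with rfl | ha <;> rcases Finset.mem_insert.mp hb with rfl | hb
    · exact absurd rfl hab
    · exact fun hc => (hnot b hb).2 hc.symm
    · exact (hnot a ha).2
    · rintro ⟨-, hc | hc⟩
      · exact hS a (hS' ha) b (hS' hb) hab hc
      · exact hS b (hS' hb) a (hS' ha) hab.symm hc

/-! ## Induced pseudo-paths as lists -/

/-- The list enumerates an induced path of `G`. -/
inductive IsInducedList {V : Type} (G : SimpleGraph V) : List V → Prop
  | single (a : V) : IsInducedList G [a]
  | cons {a b : V} {t : List V} : G.Adj a b → (∀ x ∈ t, a ≠ x ∧ ¬ G.Adj a x) →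
      IsInducedList G (b :: t) → IsInducedList G (a :: b :: t)

theorem IsInducedList.isInducedPsPath {V : Type} {E : V → V → Prop}
    (hE : ∀ u v : V, E u v → ¬ E v u) {u : List V}
    (h : IsInducedList (SimpleGraph.fromRel E) u) : IsInducedPsPath E u.get := by
  have hEx : ∀ x, ¬ E x x := fun x hx => hE x x hx hx
  have hadj : ∀ x y, (SimpleGraph.fromRel E).Adj x y ↔ E x y ∨ E y x := by
    intro x y
    rw [SimpleGraph.fromRel_adj]
    refine ⟨fun h => h.2, fun h => ⟨?_, h⟩⟩
    rintro rfl
    exact hEx x (h.elim id id)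
  suffices hs : ∀ i j : Fin u.length, (u.get i = u.get j → i = j) ∧
      ((SimpleGraph.fromRel E).Adj (u.get i) (u.get j) ↔ i.val + 1 = j.val ∨ j.val + 1 = i.val) by
    exact ⟨fun i j => (hs i j).1, fun i j => by rw [← hadj]; exact (hs i j).2⟩
  induction h with
  | single a =>
    intro i j
    obtain rfl : i = j := Subsingleton.elim (α := Fin 1) i j
    simp
  | @cons a b t hab hat h ih =>
    have h0 : ∀ j : Fin (b :: t).length, a ≠ (b :: t).get j ∧
        ((SimpleGraph.fromRel E).Adj a ((b :: t).get j) ↔ j.val = 0) := by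
      intro j
      refine Fin.cases ?_ (fun j => ?_) j
      · exact ⟨hab.ne, by simpa using hab⟩
      · have := hat _ (t.get_mem j)
        simpa using this
    intro i j
    refine Fin.cases ?_ (fun i => ?_) i <;> refine Fin.cases ?_ (fun j => ?_) j
    · simp
    · have := h0 j
      refine ⟨fun hc => absurd hc this.1, this.2.trans ?_⟩
      simp only [Fin.val_zero, Fin.val_succ]
      omega
    · have := h0 i
      refine ⟨fun hc => absurd hc.symm this.1, ?_⟩
      rw [SimpleGraph.adj_comm]
      refine this.2.trans ?_
      simp only [Fin.val_zero, Fin.val_succ]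
      omega
    · have := ih i j
      refine ⟨fun hc => congrArg Fin.succ (this.1 hc), this.2.trans ?_⟩
      simp only [Fin.val_succ]
      omega

/-- The arcs between `b` and its two neighbors `a`, `c` both leave `b` or both enter `b`. -/
def IsTurn {V : Type} (E : V → V → Prop) (a b c : V) : Prop :=
  (E b a ∧ E b c) ∨ (E a b ∧ E c b)

open Classical in
/-- The number of turns of a pseudo-path given as a list. -/
noncomputable def listTurns {V : Type} (E : V → V → Prop) : List V → ℕ
  | a :: b :: c :: t => (if IsTurn E a b c then 1 else 0) + listTurns E (b :: c :: t)
  | _ => 0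

theorem listTurns_le_cons {V : Type} (E : V → V → Prop) (a : V) (t : List V) :
    listTurns E t ≤ listTurns E (a :: t) := by
  match t with
  | [] => simp [listTurns]
  | [b] => simp [listTurns]
  | b :: c :: t => simp [listTurns]

theorem listTurns_le_turnCount {V : Type} (E : V → V → Prop) (u : List V) :
    listTurns E u ≤ turnCount E u.get := by
  match u with
  | [] => simp [listTurns]
  | [b] => simp [listTurns]
  | [b, c] => simp [listTurns]
  | a :: b :: c :: t =>
    have ih := listTurns_le_turnCount E (b :: c :: t)
    unfold turnCount at ih ⊢
    rw [listTurns]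
    set S := {i : Fin (b :: c :: t).length | ∃ j k : Fin (b :: c :: t).length,
      j.val + 1 = i.val ∧ i.val + 1 = k.val ∧
        ((E ((b :: c :: t).get i) ((b :: c :: t).get j) ∧
          E ((b :: c :: t).get i) ((b :: c :: t).get k)) ∨
        (E ((b :: c :: t).get j) ((b :: c :: t).get i) ∧
          E ((b :: c :: t).get k) ((b :: c :: t).get i)))} with hS
    set S' := {i : Fin (a :: b :: c :: t).length | ∃ j k : Fin (a :: b :: c :: t).length,
      j.val + 1 = i.val ∧ i.val + 1 = k.val ∧
        ((E ((a :: b :: c :: t).get i) ((a :: b :: c :: t).get j) ∧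
          E ((a :: b :: c :: t).get i) ((a :: b :: c :: t).get k)) ∨
        (E ((a :: b :: c :: t).get j) ((a :: b :: c :: t).get i) ∧
          E ((a :: b :: c :: t).get k) ((a :: b :: c :: t).get i)))} with hS'
    have hsub : Fin.succ '' S ⊆ S' := by
      rintro _ ⟨i, ⟨j, k, hj, hk, h⟩, rfl⟩
      exact ⟨j.succ, k.succ, by simp [← hj], by simp [← hk], h⟩
    have hcard : (Fin.succ '' S).ncard = S.ncard :=
      Set.ncard_image_of_injective _ (Fin.succ_injective _)
    by_cases hturn : IsTurn E a b c
    · rw [if_pos hturn]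
      have hnot : (⟨1, by simp⟩ : Fin (a :: b :: c :: t).length) ∉ Fin.succ '' S := by
        rintro ⟨i, ⟨j, k, hj, -⟩, hi⟩
        have := congrArg Fin.val hi
        simp only [Fin.val_succ] at this
        omega
      have hins : insert (⟨1, by simp⟩ : Fin (a :: b :: c :: t).length) (Fin.succ '' S) ⊆ S' :=
        Set.insert_subset ⟨⟨0, by simp⟩, ⟨2, by simp⟩, rfl, rfl, hturn⟩ hsub
      have := Set.ncard_le_ncard hins (Set.toFinite _)
      rw [Set.ncard_insert_of_notMem hnot (Set.toFinite _)] at this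
      omega
    · rw [if_neg hturn]
      have := Set.ncard_le_ncard hsub (Set.toFinite _)
      omega

/-- Replacing pairwise disjoint segments of the path by attached vertices that do not
fit its direction creates two turns each; hence the first neighbors of such vertices take
at most `2 * r` values for some induced pseudo-path with `r` turns. -/
theorem exists_induced_list_of_attached {V : Type} {E : V → V → Prop} {n l : ℕ} {w : ℕ → V}
    (hn : 3 ≤ n) (hF1 : ¬ HasInducedCopyG (F1G n) (SimpleGraph.fromRel E))
    (hw : IsInducedDirPathSeq E l w) (B : V → ℕ → ℕ → Prop)
    (hB : ∀ y p q, B y p q → IsSpan (SimpleGraph.fromRel E) l w y p q ∧ n ≤ p ∧ q + n + 1 ≤ l ∧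
      p + 2 ≤ q ∧ q ≤ p + 3 ∧ ¬ (E (w p) y ∧ E y (w q))) (s : ℕ) (hs : s + 1 < l) :
    ∃ (K : Finset ℕ) (t : List V),
      K.card ≤ 2 * listTurns E (w s :: w (s + 1) :: t) ∧
      (∀ y p q, B y p q → s + 1 ≤ p → p ∈ K) ∧
      IsInducedList (SimpleGraph.fromRel E) (w s :: w (s + 1) :: t) ∧
      ∀ x ∈ t, (∃ j, s + 2 ≤ j ∧ j < l ∧ x = w j) ∨ ∃ p q, s + 1 ≤ p ∧ B x p q := by
  have hwG := hw.isInducedPathSeq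
  by_cases hex : ∃ y q, B y (s + 1) q
  · obtain ⟨y, q, hy⟩ := hex
    obtain ⟨hspan, hnp, hql, hpq, hqp, hbad⟩ := hB y _ q hy
    obtain ⟨K, t, hK, hKB, hind, ht⟩ :=
      exists_induced_list_of_attached hn hF1 hw B hB q (by omega)
    have hx : ∀ x ∈ w (q + 1) :: t, (∃ j, q + 1 ≤ j ∧ j < l ∧ x = w j) ∨
        ∃ p' q', q + 1 ≤ p' ∧ B x p' q' := by
      intro x hx
      rcases List.mem_cons.mp hx with rfl | hx
      · exact Or.inl ⟨q + 1, by omega, by omega, rfl⟩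
      · rcases ht x hx with ⟨j, hj, hj', rfl⟩ | h
        · exact Or.inl ⟨j, by omega, hj', rfl⟩
        · exact Or.inr h
    have hfar : ∀ i < q, ∀ x ∈ w (q + 1) :: t,
        w i ≠ x ∧ ¬ (SimpleGraph.fromRel E).Adj (w i) x := by
      intro i hi x hxt
      rcases hx x hxt with ⟨j, hj, hj', rfl⟩ | ⟨p', q', hp', hb⟩
      · have := hwG i j (by omega) hj'
        exact ⟨fun h => by have := this.1 h; omega, fun h => by have := this.2.mp h; omega⟩
      · obtain ⟨hsp, -⟩ := hB _ _ _ hb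
        refine ⟨(hsp.ne i (by omega)).symm, fun h => ?_⟩
        have := hsp.bounds i (by omega) h.symm
        omega
    have hfarq : ∀ i, i + 1 < q → ∀ x ∈ w q :: w (q + 1) :: t,
        w i ≠ x ∧ ¬ (SimpleGraph.fromRel E).Adj (w i) x := by
      intro i hi x hxt
      rcases List.mem_cons.mp hxt with rfl | hxt
      · have := hwG i q (by omega) (by omega)
        exact ⟨fun h => by have := this.1 h; omega, fun h => by have := this.2.mp h; omega⟩
      · exact hfar i (by omega) x hxt
    have hyfar : ∀ x ∈ w (q + 1) :: t, y ≠ x ∧ ¬ (SimpleGraph.fromRel E).Adj y x := by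
      intro x hxt
      rcases hx x hxt with ⟨j, hj, hj', rfl⟩ | ⟨p', q', hp', hb⟩
      · refine ⟨hspan.ne j hj', fun h => ?_⟩
        have := hspan.bounds j hj' h
        omega
      · obtain ⟨hsp, _, _, _, _, _⟩ := hB _ _ _ hb
        refine ⟨?_, hspan.not_adj hF1 hn hwG hsp (by omega) (by omega) (by omega) (by omega)
          (by omega)⟩
        rintro rfl
        have := (hspan.unique hsp).1
        omega
    have hadj_s : (SimpleGraph.fromRel E).Adj (w s) (w (s + 1)) := by
      rw [(hwG _ _ (by omega) (by omega)).2]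
      omega
    have hys : w s ≠ y ∧ ¬ (SimpleGraph.fromRel E).Adj (w s) y := by
      refine ⟨(hspan.ne s (by omega)).symm, fun h => ?_⟩
      have := hspan.bounds s (by omega) h.symm
      omega
    refine ⟨K ∪ Finset.Icc (s + 1) q, y :: w q :: w (q + 1) :: t, ?_, ?_, ?_, ?_⟩
    · have hsE : E (w s) (w (s + 1)) := (hw.arc_iff _ _ (by omega) (by omega)).mpr rfl
      have hqE : E (w q) (w (q + 1)) := (hw.arc_iff _ _ (by omega) (by omega)).mpr rfl
      have hl := hspan.adj_left.2
      have hr := hspan.adj_right.2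
      have hturns : 2 + listTurns E (w q :: w (q + 1) :: t) ≤
          listTurns E (w s :: w (s + 1) :: y :: w q :: w (q + 1) :: t) := by
        rw [listTurns, listTurns, listTurns]
        unfold IsTurn
        by_cases h1 : E (w (s + 1)) y <;> by_cases h2 : E y (w q)
        · exact absurd ⟨h1, h2⟩ hbad
        · have h2' : E (w q) y := hr.resolve_left h2
          simp only [h1, h2', hqE, true_and, or_true, true_or, if_true]
          omega
        · have h1' : E y (w (s + 1)) := hl.resolve_right h1
          simp only [h1', h2, hsE, true_and, or_true, true_or, if_true]
          omega
        · have h1' : E y (w (s + 1)) := hl.resolve_right h1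
          have h2' : E (w q) y := hr.resolve_left h2
          simp only [h1', h2', hsE, hqE, true_and, or_true, true_or, if_true]
          omega
      have hc1 := Finset.card_union_le K (Finset.Icc (s + 1) q)
      have hc2 : (Finset.Icc (s + 1) q).card ≤ 4 := by
        rw [Nat.card_Icc]
        omega
      omega
    · intro y' p' q' hb hp'
      rw [Finset.mem_union, Finset.mem_Icc]
      by_cases hc : p' ≤ q
      · exact Or.inr ⟨hp', hc⟩
      · exact Or.inl (hKB y' p' q' hb (by omega))
    · refine .cons hadj_s ?_ (.cons hspan.adj_left.symm ?_ (.cons hspan.adj_right hyfar hind))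
      · intro x hx
        rcases List.mem_cons.mp hx with rfl | hx
        · exact hys
        · exact hfarq s (by omega) x hx
      · exact hfarq (s + 1) (by omega)
    · intro x hxt
      rcases List.mem_cons.mp hxt with rfl | hxt
      · exact Or.inr ⟨s + 1, q, le_rfl, hy⟩
      · rcases List.mem_cons.mp hxt with rfl | hxt
        · exact Or.inl ⟨q, by omega, by omega, rfl⟩
        · rcases hx x hxt with ⟨j, hj, hj', rfl⟩ | ⟨p', q', hp', hb⟩
          · exact Or.inl ⟨j, by omega, hj', rfl⟩
          · exact Or.inr ⟨p', q', by omega, hb⟩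
  · have hadj_s : (SimpleGraph.fromRel E).Adj (w s) (w (s + 1)) := by
      rw [(hwG _ _ (by omega) (by omega)).2]
      omega
    by_cases hsl : s + 2 < l
    · obtain ⟨K, t, hK, hKB, hind, ht⟩ :=
        exists_induced_list_of_attached hn hF1 hw B hB (s + 1) hsl
      refine ⟨K, w (s + 2) :: t, hK.trans ?_, ?_, .cons hadj_s ?_ hind, ?_⟩
      · exact Nat.mul_le_mul_left _ (listTurns_le_cons E _ _)
      · intro y p q hb hp
        refine hKB y p q hb ?_
        rcases hp.lt_or_eq with h | rfl
        · exact h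
        · exact absurd ⟨y, q, hb⟩ hex
      · intro x hx
        rcases List.mem_cons.mp hx with rfl | hx
        · have := hwG s (s + 2) (by omega) (by omega)
          exact ⟨fun h => by have := this.1 h; omega, fun h => by have := this.2.mp h; omega⟩
        · rcases ht x hx with ⟨j, hj, hj', rfl⟩ | ⟨p', q', hp', hb⟩
          · have := hwG s j (by omega) (by omega)
            exact ⟨fun h => by have := this.1 h; omega, fun h => by have := this.2.mp h; omega⟩
          · obtain ⟨hsp, -⟩ := hB _ _ _ hb
            refine ⟨(hsp.ne s (by omega)).symm, fun h => ?_⟩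
            have := hsp.bounds s (by omega) h.symm
            omega
      · intro x hx
        rcases List.mem_cons.mp hx with rfl | hx
        · exact Or.inl ⟨s + 2, by omega, by omega, rfl⟩
        · rcases ht x hx with ⟨j, hj, hj', rfl⟩ | ⟨p', q', hp', hb⟩
          · exact Or.inl ⟨j, by omega, hj', rfl⟩
          · exact Or.inr ⟨p', q', by omega, hb⟩
    · refine ⟨∅, [], by simp, ?_, .cons hadj_s (by simp) (.single _), by simp⟩
      intro y p q hb hp
      obtain ⟨hsp, _, _, _⟩ := hB _ _ _ hb
      omega
termination_by l - s

/-! ## Assembling the path cover -/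

/-- Directed paths `L p` that can be inserted between `w p` and `w (p + d)`, for `p` in a fixed
residue class modulo `d`, are all contained in a single directed path. -/
theorem exists_dirPath_through {V : Type} {E : V → V → Prop} {l : ℕ} {w : ℕ → V}
    (hw : IsInducedDirPathSeq E l w) {d r : ℕ} (hd : 0 < d) (L : ℕ → List V)
    (hL : ∀ p, L p ≠ [] → p % d = r ∧ p + d < l)
    (hnd : ∀ p, (L p).Nodup) (hch : ∀ p, (L p).IsChain E)
    (harc : ∀ p, ∀ x ∈ L p, E (w p) x ∧ E x (w (p + d)))
    (hne : ∀ p, ∀ x ∈ L p, ∀ i < l, x ≠ w i)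
    (hdisj : ∀ p p' x, x ∈ L p → x ∈ L p' → p = p') (s : ℕ) (hs : s < l) :
    ∃ t : List V, (w s :: t).Nodup ∧ (w s :: t).IsChain E ∧
      (∀ x ∈ w s :: t, (∃ j, s ≤ j ∧ j < l ∧ x = w j) ∨ ∃ p, s ≤ p ∧ x ∈ L p) ∧
      (∀ p, s ≤ p → ∀ x ∈ L p, x ∈ w s :: t) ∧
      (d = 1 → ∀ j, s ≤ j → j < l → w j ∈ w s :: t) := by
  by_cases hLs : L s = []
  · by_cases hsl : s + 1 < l
    · obtain ⟨t, h1, h2, h3, h4, h5⟩ :=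
        exists_dirPath_through hw hd L hL hnd hch harc hne hdisj (s + 1) hsl
      refine ⟨w (s + 1) :: t, List.nodup_cons.mpr ⟨fun hc => ?_, h1⟩, ?_, ?_, ?_, ?_⟩
      · rcases h3 _ hc with ⟨j, hj, hj', e⟩ | ⟨p, -, hp⟩
        · have := hw.inj s j hs hj' e
          omega
        · exact hne p _ hp s hs rfl
      · exact List.isChain_cons_cons.mpr ⟨(hw.arc_iff _ _ hs hsl).mpr rfl, h2⟩
      · intro x hx
        rcases List.mem_cons.mp hx with rfl | hx
        · exact Or.inl ⟨s, le_rfl, hs, rfl⟩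
        · rcases h3 x hx with ⟨j, hj, hj', e⟩ | ⟨p, hp, hxp⟩
          · exact Or.inl ⟨j, by omega, hj', e⟩
          · exact Or.inr ⟨p, by omega, hxp⟩
      · intro p hp x hx
        rcases hp.lt_or_eq with h | rfl
        · exact List.mem_cons_of_mem _ (h4 p h x hx)
        · simp [hLs] at hx
      · intro hd1 j hj hjl
        rcases hj.lt_or_eq with h | rfl
        · exact List.mem_cons_of_mem _ (h5 hd1 j h hjl)
        · exact List.mem_cons_self
    · refine ⟨[], by simp, by simp, ?_, ?_, ?_⟩
      · intro x hx
        exact Or.inl ⟨s, le_rfl, hs, by simpa using hx⟩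
      · intro p hp x hx
        have := hL p (List.ne_nil_of_mem hx)
        omega
      · intro _ j hj hjl
        obtain rfl : s = j := by omega
        simp
  · obtain ⟨hsr, hsl⟩ := hL s hLs
    obtain ⟨t, h1, h2, h3, h4, h5⟩ :=
      exists_dirPath_through hw hd L hL hnd hch harc hne hdisj (s + d) hsl
    refine ⟨L s ++ w (s + d) :: t, ?_, ?_, ?_, ?_, ?_⟩
    · rw [List.nodup_cons, List.mem_append, List.nodup_append]
      refine ⟨?_, hnd s, h1, ?_⟩
      · rintro (hc | hc)
        · exact hne s _ hc s hs rfl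
        · rcases h3 _ hc with ⟨j, hj, hj', e⟩ | ⟨p, -, hp⟩
          · have := hw.inj s j hs hj' e
            omega
          · exact hne p _ hp s hs rfl
      · rintro a ha b hb rfl
        rcases h3 _ hb with ⟨j, hj, hj', e⟩ | ⟨p, hp, hap⟩
        · exact hne s a ha j hj' e
        · have := hdisj s p a ha hap
          omega
    · rw [List.isChain_cons, List.isChain_append]
      refine ⟨?_, hch s, h2, ?_⟩
      · intro y hy
        rw [List.head?_append_of_ne_nil _ hLs] at hy
        exact (harc s y (List.mem_of_mem_head? hy)).1
      · intro x hx y hy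
        simp only [List.head?_cons, Option.mem_def, Option.some.injEq] at hy
        subst hy
        exact (harc s x (List.mem_of_mem_getLast? hx)).2
    · intro x hx
      rcases List.mem_cons.mp hx with rfl | hx
      · exact Or.inl ⟨s, le_rfl, hs, rfl⟩
      rcases List.mem_append.mp hx with hx | hx
      · exact Or.inr ⟨s, le_rfl, hx⟩
      · rcases h3 x hx with ⟨j, hj, hj', e⟩ | ⟨p, hp, hxp⟩
        · exact Or.inl ⟨j, by omega, hj', e⟩
        · exact Or.inr ⟨p, by omega, hxp⟩
    · intro p hp x hx
      refine List.mem_cons_of_mem _ (List.mem_append.mpr ?_)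
      by_cases hps : p = s
      · subst hps
        exact Or.inl hx
      · refine Or.inr (h4 p ?_ x hx)
        have hpr := (hL p (List.ne_nil_of_mem hx)).1
        have hmod : p ≡ s [MOD d] := hpr.trans hsr.symm
        have hdvd := (Nat.modEq_iff_dvd' hp).mp hmod.symm
        have := Nat.le_of_dvd (by omega) hdvd
        omega
    · intro hd1 j hj hjl
      rcases hj.lt_or_eq with h | rfl
      · exact List.mem_cons_of_mem _ (List.mem_append.mpr (Or.inr (h5 hd1 j (by omega) hjl)))
      · exact List.mem_cons_self
termination_by l - s

/-- The vertices of `S` are covered by at most `k` directed paths of `E` inside `X`. -/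
def IsCoveredBy {V : Type} (E : V → V → Prop) (X S : Set V) (k : ℕ) : Prop :=
  ∃ P : Finset (List V), P.card ≤ k ∧ (∀ l ∈ P, IsDirPathList E l ∧ ∀ v ∈ l, v ∈ X) ∧
    ∀ v ∈ S, ∃ l ∈ P, v ∈ l

namespace IsCoveredBy

variable {V : Type} {E : V → V → Prop} {X S S' : Set V} {k k' : ℕ}

theorem pcOn_le (h : IsCoveredBy E X X k) : pcOn E X ≤ k := by
  obtain ⟨P, hP, h1, h2⟩ := h
  have hle : pcOn E X ≤ P.card := by
    unfold pcOn
    refine Nat.sInf_le ?_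
    exact ⟨P, rfl, h1, h2⟩
  exact hle.trans hP

theorem of_lists (f : Fin k → List V)
    (hf : ∀ i, (f i).Nodup ∧ (f i).IsChain E ∧ ∀ x ∈ f i, x ∈ X)
    (hS : ∀ x ∈ S, ∃ i, x ∈ f i) : IsCoveredBy E X S k := by
  classical
  refine ⟨(Finset.univ.image f).filter (· ≠ []), ?_, ?_, ?_⟩
  · refine (Finset.card_filter_le _ _).trans (Finset.card_image_le.trans ?_)
    simp
  · intro L hL
    obtain ⟨hL, hne⟩ := Finset.mem_filter.mp hL
    obtain ⟨i, -, rfl⟩ := Finset.mem_image.mp hL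
    obtain ⟨h1, h2, h3⟩ := hf i
    exact ⟨⟨hne, h1, h2⟩, h3⟩
  · intro x hx
    obtain ⟨i, hi⟩ := hS x hx
    exact ⟨f i, by simp [List.ne_nil_of_mem hi], hi⟩

theorem union (h : IsCoveredBy E X S k) (h' : IsCoveredBy E X S' k') :
    IsCoveredBy E X (S ∪ S') (k + k') := by
  classical
  obtain ⟨P, hP, h1, h2⟩ := h
  obtain ⟨P', hP', h1', h2'⟩ := h'
  refine ⟨P ∪ P', (Finset.card_union_le _ _).trans (by omega), ?_, ?_⟩
  · intro L hL
    exact (Finset.mem_union.mp hL).elim (h1 L) (h1' L)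
  · rintro x (hx | hx)
    · obtain ⟨L, hL, hxL⟩ := h2 x hx
      exact ⟨L, Finset.mem_union_left _ hL, hxL⟩
    · obtain ⟨L, hL, hxL⟩ := h2' x hx
      exact ⟨L, Finset.mem_union_right _ hL, hxL⟩

theorem biUnion {ι : Type} (I : Finset ι) {S : ι → Set V}
    (h : ∀ i ∈ I, IsCoveredBy E X (S i) k) :
    IsCoveredBy E X {x | ∃ i ∈ I, x ∈ S i} (I.card * k) := by
  classical
  choose! P hP h1 h2 using h
  refine ⟨I.biUnion P, Finset.card_biUnion_le_card_mul _ _ _ hP, ?_, ?_⟩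
  · intro L hL
    obtain ⟨i, hi, hL⟩ := Finset.mem_biUnion.mp hL
    exact h1 i hi L hL
  · rintro x ⟨i, hi, hx⟩
    obtain ⟨L, hL, hxL⟩ := h2 i hi x hx
    exact ⟨L, Finset.mem_biUnion.mpr ⟨i, hi, hL⟩, hxL⟩

end IsCoveredBy

/-- An attached vertex is adjacent to two path vertices at distance at most three, and fits
between them if they are consecutive. -/
theorem exists_isSpan_of_attached {V : Type} {E : V → V → Prop} {n l : ℕ} {w : ℕ → V}
    (hn : 3 ≤ n) (hE : ∀ u v : V, E u v → ¬ E v u) (h1 : CondD1 n E) (h2 : CondD2 n E)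
    (hw : IsInducedDirPathSeq E l w) {y : V} (hne : ∀ i < l, y ≠ w i)
    (hex : ∃ i < l, (SimpleGraph.fromRel E).Adj y (w i))
    (hmid : ∀ i < l, (SimpleGraph.fromRel E).Adj y (w i) → n ≤ i ∧ i + n + 1 ≤ l) :
    ∃ p q, IsSpan (SimpleGraph.fromRel E) l w y p q ∧ n ≤ p ∧ q + n + 1 ≤ l ∧ p < q ∧
      q ≤ p + 3 ∧ (q = p + 1 → E (w p) y ∧ E y (w q)) := by
  obtain ⟨p, q, h⟩ := exists_isSpan hne hex
  have hp := (hmid p (h.le.trans_lt h.lt) h.adj_left).1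
  have hq := (hmid q h.lt h.adj_right).2
  obtain ⟨hpq, hqp⟩ := h.length_bounds h1.2.2.1 h1.2.2.2 hn hw.isInducedPathSeq hp hq
  refine ⟨p, q, h, hp, hq, hpq, hqp, ?_⟩
  rintro rfl
  have key := h2.insertable hE (u := fun i => w (p + 1 - n + i)) (x := y) ?_ ?_ (by omega)
  · rwa [show p + 1 - n + (n - 1) = p by omega, show p + 1 - n + n = p + 1 by omega] at key
  · intro i j hi hj
    refine ⟨fun e => ?_, ?_⟩
    · have := hw.inj _ _ (by omega) (by omega) e
      omega
    · rw [hw.arc_iff _ _ (by omega) (by omega)]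
      omega
  · intro i hi
    have hyi := hne (p + 1 - n + i) (by omega)
    refine ⟨hyi, fun e => ?_, ?_⟩
    · have := h.bounds _ (by omega) ⟨hyi, e⟩
      omega
    · rintro (hi' | hi')
      · rw [show p + 1 - n + i = p by omega]
        exact h.adj_left.2
      · rw [show p + 1 - n + i = p + 1 by omega]
        exact h.adj_right.2

/-- Attached vertices with span of length `d` that fit the direction of the path are covered, for
first neighbors in a fixed residue class modulo `d`, by `n - 2` directed paths; for `d = 1`
these paths also cover the given path. -/
theorem isCoveredBy_of_fitting {V : Type} [Fintype V] {E : V → V → Prop} {n l : ℕ} {w : ℕ → V}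
    (hn : 3 ≤ n) (hl : 0 < l) (hK : ¬ HasInducedCopyG (StarG n) (SimpleGraph.fromRel E))
    (hw : IsInducedDirPathSeq E l w) {Y : Set V} {d r : ℕ} (hd : 0 < d) :
    IsCoveredBy E ({x | ∃ i < l, x = w i} ∪ Y)
      {x | (d = 1 ∧ ∃ i < l, x = w i) ∨
        (x ∈ Y ∧ ∃ p, 0 < p ∧ p % d = r ∧ IsSpan (SimpleGraph.fromRel E) l w x p (p + d) ∧
          E (w p) x ∧ E x (w (p + d)))} (n - 2) := by
  classical
  let X : ℕ → Finset V := fun p => Finset.univ.filter fun x => x ∈ Y ∧ 0 < p ∧ p % d = r ∧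
    IsSpan (SimpleGraph.fromRel E) l w x p (p + d) ∧ E (w p) x ∧ E x (w (p + d))
  have hX : ∀ p x, x ∈ X p ↔ x ∈ Y ∧ 0 < p ∧ p % d = r ∧
      IsSpan (SimpleGraph.fromRel E) l w x p (p + d) ∧ E (w p) x ∧ E x (w (p + d)) := by
    simp [X]
  have hf : ∀ p, ∃ f : Fin (n - 2) → List V,
      (∀ i, (f i).Nodup ∧ (f i).IsChain E ∧ ∀ x ∈ f i, x ∈ X p) ∧ ∀ x ∈ X p, ∃ i, x ∈ f i := by
    intro p
    rcases Nat.eq_zero_or_pos p with rfl | hp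
    · exact ⟨fun _ => [], by simp, fun x hx => absurd ((hX _ _).mp hx).2.1 (by simp)⟩
    · exact exists_paths_of_common_start hK hn hw hp (X p)
        fun y hy => ⟨_, ((hX _ _).mp hy).2.2.2.1⟩
  choose f hf hfc using hf
  have hmem : ∀ p i x, x ∈ f p i → x ∈ Y ∧ 0 < p ∧ p % d = r ∧
      IsSpan (SimpleGraph.fromRel E) l w x p (p + d) ∧ E (w p) x ∧ E x (w (p + d)) :=
    fun p i x hx => (hX p x).mp ((hf p i).2.2 x hx)
  have hW := fun i => exists_dirPath_through hw (r := r) hd (fun p => f p i)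
    (fun p hp => by
      obtain ⟨x, hx⟩ := List.exists_mem_of_ne_nil _ hp
      obtain ⟨-, -, hr, hsp, -⟩ := hmem p i x hx
      exact ⟨hr, hsp.lt⟩)
    (fun p => (hf p i).1) (fun p => (hf p i).2.1)
    (fun p x hx => (hmem p i x hx).2.2.2.2)
    (fun p x hx => (hmem p i x hx).2.2.2.1.ne)
    (fun p p' x hx hx' =>
      ((hmem p i x hx).2.2.2.1.unique (hmem p' i x hx').2.2.2.1).1) 0 hl
  choose t h1 h2 h3 h4 h5 using hW
  refine .of_lists (fun i => w 0 :: t i) (fun i => ⟨h1 i, h2 i, fun x hx => ?_⟩) ?_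
  · rcases h3 i x hx with ⟨j, -, hj, e⟩ | ⟨p, -, hp⟩
    · exact Or.inl ⟨j, hj, e⟩
    · exact Or.inr (hmem p i x hp).1
  · rintro x (⟨hd1, j, hj, rfl⟩ | ⟨hxY, p, hp⟩)
    · exact ⟨⟨0, by omega⟩, h5 _ hd1 j (Nat.zero_le _) hj⟩
    · obtain ⟨i, hi⟩ := hfc p x ((hX p x).mpr ⟨hxY, hp⟩)
      exact ⟨i, h4 i p (Nat.zero_le _) x hi⟩

/-- Attached vertices with a common first neighbor are covered by `n - 2` directed paths. -/
theorem isCoveredBy_of_common_start {V : Type} [Fintype V] {E : V → V → Prop} {n l p : ℕ}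
    {w : ℕ → V} (hn : 3 ≤ n) (hK : ¬ HasInducedCopyG (StarG n) (SimpleGraph.fromRel E))
    (hw : IsInducedDirPathSeq E l w) {X S : Set V} (hSX : S ⊆ X)
    (hS : ∀ y ∈ S, 0 < p ∧ ∃ q, IsSpan (SimpleGraph.fromRel E) l w y p q) :
    IsCoveredBy E X S (n - 2) := by
  classical
  rcases Nat.eq_zero_or_pos p with rfl | hp
  · exact ⟨∅, by simp, by simp, fun y hy => absurd (hS y hy).1 (by simp)⟩
  · obtain ⟨f, hf, hfc⟩ := exists_paths_of_common_start hK hn hw hp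
      (Finset.univ.filter (· ∈ S)) fun y hy => (hS y (by simpa using hy)).2
    refine .of_lists f (fun i => ⟨(hf i).1, (hf i).2.1, fun x hx => hSX ?_⟩)
      fun x hx => hfc x (by simpa using hx)
    simpa using (hf i).2.2 x hx

/-- Let `n ≥ 3` and let `D` satisfy (D1), (D2), (D3).  Let
`Q = v₁⋯v_l` be an induced directed path of `D` and `Y' ⊆ N_{G_D}(V(Q))` with
`N_{G_D}(y) ∩ V(Q) ⊆ {v_{n+1}, …, v_{l−n}}` for all `y ∈ Y'`.  Then
`pc(D[V(Q) ∪ Y']) ≤ (n−2)n(n+5)/2 + 6(n−2)`.  (Indices are 0-based.) -/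
theorem pc_of_induced_dirpath_with_neighbors (n : ℕ) (hn : 3 ≤ n)
    (V : Type) [Fintype V] (E : V → V → Prop)
    (hE : ∀ u v : V, E u v → ¬ E v u)
    (h1 : CondD1 n E) (h2 : CondD2 n E) (h3 : CondD3 n E)
    (l : ℕ) (hl : 0 < l) (v : Fin l → V)
    (hQind : IsInducedPsPath E v)
    (hQdir : ∀ i j : Fin l, i.val + 1 = j.val → E (v i) (v j))
    (Y' : Set V)
    (hY' : ∀ y ∈ Y', y ∉ Set.range v ∧ ∃ i : Fin l, (SimpleGraph.fromRel E).Adj y (v i))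
    (hmid : ∀ y ∈ Y', ∀ i : Fin l, (SimpleGraph.fromRel E).Adj y (v i) →
      n ≤ i.val ∧ i.val + n + 1 ≤ l) :
    pcOn E (Set.range v ∪ Y') ≤ (n - 2) * n * (n + 5) / 2 + 6 * (n - 2) := by
  let w : ℕ → V := fun i => if h : i < l then v ⟨i, h⟩ else v ⟨0, hl⟩
  have hwv : ∀ i (h : i < l), w i = v ⟨i, h⟩ := fun i h => by simp [w, h]
  have hw : IsInducedDirPathSeq E l w := by
    refine ⟨fun i j hi hj e => ?_, fun i j hi hj => ?_⟩
    · rw [hwv i hi, hwv j hj] at e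
      exact congrArg Fin.val (hQind.1 e)
    · rw [hwv i hi, hwv j hj]
      refine ⟨fun h => ?_, fun h => hQdir _ _ h⟩
      rcases (hQind.2 ⟨i, hi⟩ ⟨j, hj⟩).mp (Or.inl h) with h' | h'
      · exact h'
      · exact absurd (hQdir ⟨j, hj⟩ ⟨i, hi⟩ h') (hE _ _ h)
  have hrange : Set.range v = {x | ∃ i < l, x = w i} := by
    ext x
    constructor
    · rintro ⟨i, rfl⟩
      exact ⟨i.val, i.isLt, (hwv _ _).symm⟩
    · rintro ⟨i, hi, rfl⟩
      exact ⟨⟨i, hi⟩, (hwv i hi).symm⟩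
  have hspan : ∀ y ∈ Y', ∃ p q, IsSpan (SimpleGraph.fromRel E) l w y p q ∧ n ≤ p ∧
      q + n + 1 ≤ l ∧ p < q ∧ q ≤ p + 3 ∧ (q = p + 1 → E (w p) y ∧ E y (w q)) := by
    intro y hy
    obtain ⟨hyv, i, hi⟩ := hY' y hy
    refine exists_isSpan_of_attached hn hE h1 h2 hw ?_ ⟨i.val, i.isLt, by rwa [hwv]⟩ ?_
    · rintro j hj rfl
      exact hyv ⟨⟨j, hj⟩, (hwv j hj).symm⟩
    · intro j hj hadj
      rw [hwv j hj] at hadj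
      exact hmid y hy ⟨j, hj⟩ hadj
  let B : V → ℕ → ℕ → Prop := fun y p q => y ∈ Y' ∧
    IsSpan (SimpleGraph.fromRel E) l w y p q ∧ ¬ (E (w p) y ∧ E y (w q))
  have hB : ∀ y p q, B y p q → IsSpan (SimpleGraph.fromRel E) l w y p q ∧ n ≤ p ∧
      q + n + 1 ≤ l ∧ p + 2 ≤ q ∧ q ≤ p + 3 ∧ ¬ (E (w p) y ∧ E y (w q)) := by
    rintro y p q ⟨hy, hsp, hbad⟩
    obtain ⟨p', q', hsp', hp, hq, hpq, hqp, hfit⟩ := hspan y hy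
    obtain ⟨rfl, rfl⟩ := hsp.unique hsp'
    refine ⟨hsp, hp, hq, ?_, hqp, hbad⟩
    rcases Nat.lt_or_ge (p + 1) q with h | h
    · exact h
    · exact absurd (hfit (by omega)) hbad
  obtain ⟨K, hKcard, hKB⟩ : ∃ K : Finset ℕ, K.card ≤ 2 * n ∧ ∀ y p q, B y p q → p ∈ K := by
    by_cases hl1 : 0 + 1 < l
    · obtain ⟨K, t, hK, hKB, hind, -⟩ :=
        exists_induced_list_of_attached hn h1.2.2.1 hw B hB 0 hl1
      refine ⟨K, hK.trans (Nat.mul_le_mul_left _ ?_), fun y p q h => hKB y p q h ?_⟩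
      · exact (listTurns_le_turnCount E _).trans (h3 _ _ (hind.isInducedPsPath hE))
      · have := (hB y p q h).2.1
        omega
    · refine ⟨∅, by simp, fun y p q h => ?_⟩
      have := (hB y p q h).2.2.1
      omega
  have hfit := IsCoveredBy.biUnion ((Finset.Icc 1 3).sigma fun d => Finset.range d)
    fun i hi => isCoveredBy_of_fitting (Y := Y') (d := i.1) (r := i.2) hn hl h1.2.1 hw
      (Finset.mem_Icc.mp (Finset.mem_sigma.mp hi).1).1
  have hrest := IsCoveredBy.biUnion (X := {x | ∃ i < l, x = w i} ∪ Y')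
    (S := fun p => {y | ∃ q, B y p q}) K
    fun p _ => isCoveredBy_of_common_start (p := p) hn h1.2.1 hw
      (fun y ⟨q, h⟩ => Or.inr h.1)
      (fun y ⟨q, h⟩ => ⟨by have := (hB y p q h).2.1; omega, q, h.2.1⟩)
  obtain ⟨P, hP, hP1, hP2⟩ := hfit.union hrest
  rw [hrange]
  refine (IsCoveredBy.pcOn_le ⟨P, hP, hP1, fun x hx => hP2 x ?_⟩).trans ?_
  · rcases hx with hx | hx
    · exact Or.inl ⟨⟨1, 0⟩, by decide, Or.inl ⟨rfl, hx⟩⟩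
    · obtain ⟨p, q, hsp, hp, -, hpq, hqp, -⟩ := hspan x hx
      by_cases hg : E (w p) x ∧ E x (w q)
      · obtain ⟨d, rfl⟩ := Nat.exists_eq_add_of_lt hpq
        refine Or.inl ⟨⟨d + 1, p % (d + 1)⟩, ?_, Or.inr ⟨hx, p, by omega, rfl, hsp, hg⟩⟩
        rw [Finset.mem_sigma, Finset.mem_Icc, Finset.mem_range]
        dsimp only
        exact ⟨⟨by omega, by omega⟩, Nat.mod_lt _ (by omega)⟩
      · exact Or.inr ⟨p, hKB x p q ⟨hx, hsp, hg⟩, q, hx, hsp, hg⟩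
  · have hsix : ((Finset.Icc 1 3).sigma fun d => Finset.range d).card = 6 := by decide
    have hbound : K.card * (n - 2) ≤ (n - 2) * n * (n + 5) / 2 := by
      rw [Nat.le_div_iff_mul_le (by norm_num)]
      calc K.card * (n - 2) * 2 ≤ 2 * n * (n - 2) * 2 := by gcongr
        _ = (n - 2) * n * 4 := by ring
        _ ≤ (n - 2) * n * (n + 5) := by gcongr; omega
    rw [hsix]
    omega
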